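/- arXiv:2111.05394 — 7 statements merged into one kernel-verified Lean document; each statement's English description precedes it below -/
import Mathlib

section
/- Let n ≥ 3 be an integer, let Y = Z_4 × (Z_2)^{n−2}, and let U be a subgroup of Y of order 2^{n−1}. Let a, b, c be nonnegative integers with 3a + 4b + 5c = 2^n − 1 and b ≥ 2^{n−3}. If there exists a family of pairwise disjoint zero-sum subsets of U \ {0} consisting of a subsets of cardinality 3, b − 2^{n−3} subsets of cardinality 4, and c subsets of cardinality 5, then there exists a family of pairwise disjoint zero-sum subsets of Y \ {0} consisting of a subsets of cardinality 3, b subsets of cardinality 4, and c subsets of cardinality 5. -/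
/-- The group `Z_4 × (Z_2)^(n-2)`. -/
abbrev Ygrp (n : ℕ) : Type := ZMod 4 × (Fin (n - 2) → ZMod 2)

/-- If an abelian group of exponent dividing four has a subgroup `U` containing a zero-sum subgroup
`F` of order four, then the complement of `U` splits into zero-sum four-element sets, namely
cosets of `F`. -/
theorem exists_zeroSum_partition_compl {G : Type*} [AddCommGroup G] [Fintype G] [DecidableEq G]
    (hG : ∀ x : G, 4 • x = 0) (U : AddSubgroup G) (F : Finset G) (hFU : ∀ x ∈ F, x ∈ U)
    (h0 : 0 ∈ F) (hsub : ∀ x ∈ F, ∀ y ∈ F, x - y ∈ F) (hcard : F.card = 4)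
    (hsum : ∑ x ∈ F, x = 0) :
    ∃ Q : Finset (Finset G),
      (∀ s ∈ Q, ∀ x ∈ s, x ∉ U) ∧
      (∀ s ∈ Q, ∀ t ∈ Q, s ≠ t → Disjoint s t) ∧
      (∀ s ∈ Q, ∑ x ∈ s, x = 0) ∧
      (∀ s ∈ Q, s.card = 4) ∧
      Q.card * 4 + Nat.card U = Nat.card G := by
  classical
  have hneg : ∀ x ∈ F, -x ∈ F := fun x hx => by simpa using hsub 0 h0 x hx
  have hadd : ∀ x ∈ F, ∀ y ∈ F, x + y ∈ F := fun x hx y hy => by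
    simpa using hsub x hx (-y) (hneg y hy)
  let coset : G → Finset G := fun y => F.map (addLeftEmbedding y)
  have mem_coset : ∀ y x, x ∈ coset y ↔ x - y ∈ F := by
    intro y x
    simp only [coset, Finset.mem_map, addLeftEmbedding_apply]
    constructor
    · rintro ⟨z, hz, rfl⟩
      simpa using hz
    · intro h
      exact ⟨x - y, h, by abel⟩
  let C : Finset G := Finset.univ.filter (fun x => x ∉ U)
  have hQU : ∀ s ∈ C.image coset, ∀ x ∈ s, x ∉ U := by
    intro s hs x hx hxU
    obtain ⟨y, hy, rfl⟩ := Finset.mem_image.1 hs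
    have h := hFU _ ((mem_coset y x).1 hx)
    have hyU : y ∉ U := (Finset.mem_filter.1 hy).2
    exact hyU (by simpa using U.sub_mem hxU h)
  have hdisj : ∀ s ∈ C.image coset, ∀ t ∈ C.image coset, s ≠ t → Disjoint s t := by
    intro s hs t ht hst
    obtain ⟨y, -, rfl⟩ := Finset.mem_image.1 hs
    obtain ⟨z, -, rfl⟩ := Finset.mem_image.1 ht
    rw [Finset.disjoint_left]
    intro x hxy hxz
    rw [mem_coset] at hxy hxz
    apply hst
    have hyz : y - z ∈ F := by simpa using hsub _ hxz _ hxy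
    ext v
    rw [mem_coset, mem_coset]
    constructor
    · intro h
      simpa using hadd _ h _ hyz
    · intro h
      simpa using hsub _ h _ hyz
  have hQ4 : ∀ s ∈ C.image coset, s.card = 4 := by
    intro s hs
    obtain ⟨y, -, rfl⟩ := Finset.mem_image.1 hs
    simpa [coset] using hcard
  refine ⟨C.image coset, hQU, hdisj, ?_, hQ4, ?_⟩
  · intro s hs
    obtain ⟨y, -, rfl⟩ := Finset.mem_image.1 hs
    rw [Finset.sum_map]
    simp only [addLeftEmbedding_apply]
    rw [Finset.sum_add_distrib, hsum, Finset.sum_const, hcard, hG, add_zero]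
  · have hunion : (C.image coset).biUnion (fun s => s) = C := by
      ext x
      simp only [Finset.mem_biUnion]
      constructor
      · rintro ⟨s, hs, hx⟩
        exact Finset.mem_filter.2 ⟨Finset.mem_univ _, hQU s hs x hx⟩
      · intro hx
        exact ⟨coset x, Finset.mem_image_of_mem _ hx, by simpa [mem_coset] using h0⟩
    have hC : C.card = (C.image coset).card * 4 := by
      conv_lhs => rw [← hunion]
      rw [Finset.card_biUnion (fun s hs t ht hst => hdisj s hs t ht hst)]
      exact Finset.sum_const_nat hQ4
    have hsplit := Finset.card_filter_add_card_filter_not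
      (s := (Finset.univ : Finset G)) (fun x => x ∈ U)
    have hUcard : Nat.card U = (Finset.univ.filter (fun x => x ∈ U)).card := by
      rw [Nat.card_eq_fintype_card]
      exact Fintype.card_subtype _
    rw [← hC, hUcard, Nat.card_eq_fintype_card, ← Finset.card_univ, add_comm]
    exact hsplit

/-- A subgroup `U` with at least three elements killed by two contains a zero-sum Klein
four-subgroup. -/
theorem exists_zeroSum_klein_four {G : Type*} [AddCommGroup G] [DecidableEq G]
    (U : AddSubgroup G) (S : Finset G) (hSU : ∀ x ∈ S, x ∈ U) (hS2 : ∀ x ∈ S, x + x = 0)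
    (hS : 3 ≤ S.card) :
    ∃ F : Finset G, (∀ x ∈ F, x ∈ U) ∧ 0 ∈ F ∧ (∀ x ∈ F, ∀ y ∈ F, x - y ∈ F) ∧
      F.card = 4 ∧ ∑ x ∈ F, x = 0 := by
  obtain ⟨u, hu, hu0⟩ := Finset.exists_mem_notMem_of_card_lt_card
    (s := {0}) (t := S) (by simp; omega)
  obtain ⟨w, hw, hw0⟩ := Finset.exists_mem_notMem_of_card_lt_card
    (s := {0, u}) (t := S) (lt_of_le_of_lt Finset.card_le_two (by omega))
  have hu2 := hS2 u hu
  have hw2 := hS2 w hw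
  have hnu : -u = u := neg_eq_of_add_eq_zero_left hu2
  have hnw : -w = w := neg_eq_of_add_eq_zero_left hw2
  simp only [Finset.mem_insert, Finset.mem_singleton, not_or] at hu0 hw0
  have huw : u + w ≠ 0 := fun h => hw0.2 (by rw [← neg_eq_of_add_eq_zero_right h, hnu])
  have hcard : ({0, u, w, u + w} : Finset G).card = 4 := by
    rw [Finset.card_insert_of_notMem, Finset.card_insert_of_notMem, Finset.card_pair]
    · simpa using hu0
    · simp [hw0.1, Ne.symm hw0.2]
    · simp [Ne.symm hu0, Ne.symm hw0.1, Ne.symm huw]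
  refine ⟨{0, u, w, u + w}, ?_, by simp, ?_, hcard, ?_⟩
  · have := hSU u hu
    have := hSU w hw
    simp only [Finset.mem_insert, Finset.mem_singleton]
    rintro x (rfl | rfl | rfl | rfl)
    · exact U.zero_mem
    · assumption
    · assumption
    · exact U.add_mem ‹_› ‹_›
  · have e1 : u - w = u + w := by rw [sub_eq_add_neg, hnw]
    have e2 : w - u = u + w := by rw [sub_eq_add_neg, hnu, add_comm]
    have e3 : u - (u + w) = w := by rw [sub_add_cancel_left, hnw]
    have e4 : w - (u + w) = u := by rw [sub_add_cancel_right, hnu]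
    simp only [Finset.mem_insert, Finset.mem_singleton]
    rintro x (rfl | rfl | rfl | rfl) y (rfl | rfl | rfl | rfl) <;>
      simp_all [add_comm]
  · rw [Finset.sum_insert, Finset.sum_insert, Finset.sum_pair]
    · calc 0 + (u + (w + (u + w))) = (u + u) + (w + w) := by abel
        _ = 0 := by rw [hu2, hw2, add_zero]
    · simpa using hu0
    · simp [hw0.1, Ne.symm hw0.2]
    · simp [Ne.symm hu0, Ne.symm hw0.1, Ne.symm huw]

theorem Ygrp.four_nsmul (n : ℕ) (x : Ygrp n) : 4 • x = 0 := by
  obtain ⟨y, v⟩ := x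
  have h4 : ∀ y : ZMod 4, 4 • y = 0 := by decide
  have h2 : ∀ y : ZMod 2, 4 • y = 0 := by decide
  ext i
  · exact h4 y
  · exact h2 (v i)

theorem Ygrp.natCard (n : ℕ) (hn : 2 ≤ n) : Nat.card (Ygrp n) = 2 ^ n := by
  obtain ⟨k, rfl⟩ := Nat.exists_eq_add_of_le hn
  simp [Ygrp, Nat.card_eq_fintype_card, pow_add]

/-- The elements of a subgroup of `Ygrp n` that are killed by two make up at least half of it. -/
theorem Ygrp.card_le_two_mul_card_two_torsion (n : ℕ) (U : AddSubgroup (Ygrp n))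
    [DecidablePred (· ∈ U)] :
    Nat.card U ≤ 2 * (Finset.univ.filter (fun x : Ygrp n => x ∈ U ∧ x + x = 0)).card := by
  let f : U →+ ZMod 2 := ((ZMod.castHom (by norm_num : 2 ∣ 4) (ZMod 2)).toAddMonoidHom.comp
    (AddMonoidHom.fst (ZMod 4) (Fin (n - 2) → ZMod 2))).comp U.subtype
  have hker : ∀ x : U, f x = 0 → (x : Ygrp n) + x = 0 := by
    intro x hx
    have h4 : ∀ y : ZMod 4, ZMod.castHom (by norm_num : 2 ∣ 4) (ZMod 2) y = 0 → y + y = 0 := by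
      decide
    have h2 : ∀ y : ZMod 2, y + y = 0 := by decide
    ext i
    · exact h4 _ hx
    · exact h2 _
  have hcard := f.ker.card_eq_card_quotient_mul_card_addSubgroup
  have hquot : Nat.card (U ⧸ f.ker) ≤ 2 := by
    rw [Nat.card_congr (QuotientAddGroup.quotientKerEquivRange f).toEquiv]
    calc Nat.card f.range ≤ Nat.card (ZMod 2) := AddSubgroup.card_le_card_addGroup _
      _ = 2 := by simp
  have hkc : Nat.card f.ker ≤
      (Finset.univ.filter (fun x : Ygrp n => x ∈ U ∧ x + x = 0)).card := by
    rw [← Fintype.card_subtype, ← Nat.card_eq_fintype_card]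
    refine Nat.card_le_card_of_injective
      (fun x : f.ker => ⟨(x : U), (x : U).2, hker x x.2⟩) fun x y h => ?_
    exact Subtype.ext (Subtype.ext (Subtype.mk.inj h))
  rw [hcard]
  exact Nat.mul_le_mul hquot hkc


/-- if `U` is a subgroup of `Y = Z_4 × (Z_2)^(n-2)` of order `2^(n-1)`,
`3a + 4b + 5c = 2^n - 1`, `b ≥ 2^(n-3)`, and `(a, b - 2^(n-3), c)` is realizable in
`U \ {0}`, then `(a, b, c)` is realizable in `Y \ {0}`. -/
theorem realizable_lift_from_index_two_subgroup (n : ℕ) (hn : 3 ≤ n)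
    (U : AddSubgroup (Ygrp n)) (hU : Nat.card U = 2 ^ (n - 1))
    (a b c : ℕ) (habc : 3 * a + 4 * b + 5 * c = 2 ^ n - 1) (hb : 2 ^ (n - 3) ≤ b)
    (hhyp : ∃ P : Finset (Finset (Ygrp n)),
      (∀ s ∈ P, ∀ x ∈ s, x ∈ U ∧ x ≠ 0) ∧
      (∀ s ∈ P, ∀ t ∈ P, s ≠ t → Disjoint s t) ∧
      (∀ s ∈ P, ∑ x ∈ s, x = 0) ∧
      (∀ s ∈ P, s.card = 3 ∨ s.card = 4 ∨ s.card = 5) ∧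
      (P.filter (fun s => s.card = 3)).card = a ∧
      (P.filter (fun s => s.card = 4)).card = b - 2 ^ (n - 3) ∧
      (P.filter (fun s => s.card = 5)).card = c) :
    ∃ P : Finset (Finset (Ygrp n)),
      (∀ s ∈ P, ∀ x ∈ s, x ≠ (0 : Ygrp n)) ∧
      (∀ s ∈ P, ∀ t ∈ P, s ≠ t → Disjoint s t) ∧
      (∀ s ∈ P, ∑ x ∈ s, x = 0) ∧
      (∀ s ∈ P, s.card = 3 ∨ s.card = 4 ∨ s.card = 5) ∧
      (P.filter (fun s => s.card = 3)).card = a ∧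
      (P.filter (fun s => s.card = 4)).card = b ∧
      (P.filter (fun s => s.card = 5)).card = c := by
  classical
  obtain ⟨P, hPU, hPd, hP0, hPc, h3, h4, h5⟩ := hhyp
  have hF : ∃ F : Finset (Ygrp n), (∀ x ∈ F, x ∈ U) ∧ 0 ∈ F ∧
      (∀ x ∈ F, ∀ y ∈ F, x - y ∈ F) ∧ F.card = 4 ∧ ∑ x ∈ F, x = 0 := by
    rcases hn.eq_or_lt with rfl | hn4
    · have ha : 0 < a := by
        norm_num at habc hb
        omega
      rw [← h3, Finset.card_pos] at ha
      obtain ⟨s, hs⟩ := ha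
      obtain ⟨hsP, hs3⟩ := Finset.mem_filter.1 hs
      have h0s : (0 : Ygrp 3) ∉ s := fun h => (hPU s hsP 0 h).2 rfl
      have hUc : (Finset.univ.filter (fun x => x ∈ U)).card = 4 := by
        rw [← Fintype.card_subtype, ← Nat.card_eq_fintype_card]
        exact hU
      have hsU : insert 0 s = Finset.univ.filter (fun x => x ∈ U) := by
        apply Finset.eq_of_subset_of_card_le
        · intro x hx
          rcases Finset.mem_insert.1 hx with rfl | hx
          · simp
          · simpa using (hPU s hsP x hx).1
        · rw [hUc, Finset.card_insert_of_notMem h0s, hs3]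
      refine ⟨Finset.univ.filter (fun x => x ∈ U), by simp, by simp, ?_, hUc, ?_⟩
      · intro x hx y hy
        simp only [Finset.mem_filter, Finset.mem_univ, true_and] at hx hy ⊢
        exact U.sub_mem hx hy
      · rw [← hsU, Finset.sum_insert h0s, hP0 s hsP, add_zero]
    · have h := Ygrp.card_le_two_mul_card_two_torsion n U
      have h8 : 2 ^ 3 ≤ 2 ^ (n - 1) := Nat.pow_le_pow_right (by norm_num) (by omega)
      refine exists_zeroSum_klein_four U
        (Finset.univ.filter (fun x : Ygrp n => x ∈ U ∧ x + x = 0)) ?_ ?_ (by omega)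
      · intro x hx
        exact (Finset.mem_filter.1 hx).2.1
      · intro x hx
        exact (Finset.mem_filter.1 hx).2.2
  obtain ⟨F, hFU, hF0, hFsub, hFcard, hFsum⟩ := hF
  obtain ⟨Q, hQU, hQd, hQ0, hQ4, hQc⟩ :=
    exists_zeroSum_partition_compl (Ygrp.four_nsmul n) U F hFU hF0 hFsub hFcard hFsum
  have hQcard : Q.card = 2 ^ (n - 3) := by
    rw [hU, Ygrp.natCard n (by omega)] at hQc
    obtain ⟨k, rfl⟩ := Nat.exists_eq_add_of_le hn
    have e1 : 3 + k - 1 = k + 2 := by omega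
    have e2 : 3 + k - 3 = k := by omega
    rw [e1, pow_add, pow_add] at hQc
    rw [e2]
    omega
  have hPQ : ∀ s ∈ P, ∀ t ∈ Q, Disjoint s t := fun s hs t ht =>
    Finset.disjoint_left.2 fun x hx hx' => hQU t ht x hx' (hPU s hs x hx).1
  have hdisj : Disjoint P Q := by
    rw [Finset.disjoint_left]
    intro s hs hs'
    have h := hQ4 s hs'
    rw [disjoint_self.1 (hPQ s hs s hs')] at h
    simp at h
  have hfilter : ∀ k, ((P ∪ Q).filter (fun s => s.card = k)).card =
      (P.filter (fun s => s.card = k)).card + (Q.filter (fun s => s.card = k)).card := by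
    intro k
    rw [Finset.filter_union, Finset.card_union_of_disjoint]
    exact Finset.disjoint_filter_filter hdisj
  have hQne : ∀ k, k ≠ 4 → (Q.filter (fun s => s.card = k)).card = 0 := by
    intro k hk
    rw [Finset.card_eq_zero, Finset.filter_eq_empty_iff]
    intro s hs h
    exact hk (h.symm.trans (hQ4 s hs))
  refine ⟨P ∪ Q, ?_, ?_, ?_, ?_, ?_, ?_, ?_⟩
  · intro s hs x hx
    rcases Finset.mem_union.1 hs with hs | hs
    · exact (hPU s hs x hx).2
    · rintro rfl
      exact hQU s hs 0 hx U.zero_mem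
  · intro s hs t ht hst
    rcases Finset.mem_union.1 hs with hs | hs <;> rcases Finset.mem_union.1 ht with ht | ht
    · exact hPd s hs t ht hst
    · exact hPQ s hs t ht
    · exact (hPQ t ht s hs).symm
    · exact hQd s hs t ht hst
  · intro s hs
    exact (Finset.mem_union.1 hs).elim (hP0 s) (hQ0 s)
  · intro s hs
    exact (Finset.mem_union.1 hs).elim (hPc s) fun h => Or.inr (Or.inl (hQ4 s h))
  · rw [hfilter, hQne 3 (by norm_num), h3, add_zero]
  · rw [hfilter, h4, Finset.filter_true_of_mem hQ4, hQcard, Nat.sub_add_cancel hb]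
  · rw [hfilter, hQne 5 (by norm_num), h5, add_zero]
end

section
/- Let n ≥ 3 be an integer and let Y = Z_4 × (Z_2)^{n−2}. Let W be a subgroup of Y isomorphic to (Z_2)^3 and let P be a zero-sum subset of Y of cardinality 3 such that W ∩ ⟨P⟩ = {0}, where ⟨P⟩ is the subgroup of Y generated by P. Then there exists a family of 8 pairwise disjoint zero-sum subsets of the sumset W + P = {w + p : w ∈ W, p ∈ P}, each of cardinality 3. -/
open Pointwise

/-- If `W` meets the subgroup generated by `P` trivially, then an element of `W + P` has a unique
decomposition as a sum. -/
theorem AddSubgroup.add_eq_add_of_inf_closure_eq_bot {G : Type*} [AddCommGroup G]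
    {W : AddSubgroup G} {P : Set G} (h : W ⊓ AddSubgroup.closure P = ⊥) {x y a b : G}
    (hx : x ∈ W) (hy : y ∈ W) (ha : a ∈ P) (hb : b ∈ P) (hxy : x + a = y + b) :
    x = y ∧ a = b := by
  have hsub : x - y = b - a := by
    rw [sub_eq_sub_iff_add_eq_add, hxy, add_comm]
  have hmem : x - y ∈ W ⊓ AddSubgroup.closure P :=
    AddSubgroup.mem_inf.mpr ⟨sub_mem hx hy,
      hsub ▸ sub_mem (AddSubgroup.subset_closure hb) (AddSubgroup.subset_closure ha)⟩
  rw [h, AddSubgroup.mem_bot] at hmem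
  exact ⟨sub_eq_zero.mp hmem, (sub_eq_zero.mp (hsub ▸ hmem)).symm⟩

/-- The group `(Z_2)^3` has three permutations adding up to zero; they come from
multiplication by `1`, `α` and `1 + α` in the field with `8` elements, where `α ^ 3 = α + 1`. -/
theorem exists_injective_add_add_eq_zero :
    ∃ σ τ : (Fin 3 → ZMod 2) → (Fin 3 → ZMod 2), Function.Injective σ ∧ Function.Injective τ ∧
      ∀ v, v + σ v + τ v = 0 := by
  refine ⟨fun v => ![v 2, v 0 + v 2, v 1], fun v => ![v 0 + v 2, v 0 + v 1 + v 2, v 1 + v 2],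
    ?_, ?_, ?_⟩ <;> decide

/-- if `W ≤ Y = Z_4 × (Z_2)^(n-2)` is a subgroup isomorphic to `(Z_2)^3`
and `P` is a zero-sum 3-subset of `Y` with `W ∩ ⟨P⟩ = {0}`, then `(8,0,0)` is
realizable in the sumset `W + P`: there are 8 pairwise disjoint zero-sum subsets of
`W + P`, each of cardinality 3. -/
theorem realizable_eight_triples_in_sumset (n : ℕ) (hn : 3 ≤ n)
    (W : AddSubgroup (Ygrp n)) (hW : Nonempty (W ≃+ (Fin 3 → ZMod 2)))
    (P : Finset (Ygrp n)) (hPcard : P.card = 3) (hPsum : ∑ x ∈ P, x = 0)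
    (hWP : W ⊓ AddSubgroup.closure (P : Set (Ygrp n)) = ⊥) :
    ∃ F : Fin 8 → Finset (Ygrp n),
      (∀ i j, i ≠ j → Disjoint (F i) (F j)) ∧
      (∀ i, (↑(F i) : Set (Ygrp n)) ⊆ (W : Set (Ygrp n)) + (P : Set (Ygrp n))) ∧
      (∀ i, (F i).card = 3) ∧
      (∀ i, ∑ x ∈ F i, x = 0) := by
  classical
  obtain ⟨e⟩ := hW
  obtain ⟨p, q, r, hpq, hpr, hqr, rfl⟩ := Finset.card_eq_three.mp hPcard
  obtain ⟨σ, τ, hσ, hτ, hsum⟩ := exists_injective_add_add_eq_zero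
  have key {x y a b : Ygrp n} := AddSubgroup.add_eq_add_of_inf_closure_eq_bot hWP (x := x) (y := y)
    (a := a) (b := b)
  have hpqr : p + q + r = 0 := by
    rw [Finset.sum_insert (by simp [hpq, hpr]), Finset.sum_pair hqr] at hPsum
    rw [add_assoc, hPsum]
  have inj {v w : Fin 3 → ZMod 2} (h : (e.symm v : Ygrp n) = e.symm w) : v = w :=
    e.symm.injective (Subtype.ext h)
  have hne (u v : Fin 3 → ZMod 2) {a b : Ygrp n} (ha : a ∈ ({p, q, r} : Finset (Ygrp n)))
      (hb : b ∈ ({p, q, r} : Finset (Ygrp n)))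
      (h : (e.symm u : Ygrp n) + a = e.symm v + b) : u = v ∧ a = b :=
    (key (e.symm u).2 (e.symm v).2 ha hb h).imp_left inj
  have hp : p ∈ ({p, q, r} : Finset (Ygrp n)) := by simp
  have hq : q ∈ ({p, q, r} : Finset (Ygrp n)) := by simp
  have hr : r ∈ ({p, q, r} : Finset (Ygrp n)) := by simp
  let f : Fin 8 ≃ (Fin 3 → ZMod 2) := Fintype.equivOfCardEq (by simp)
  have h₁ (u v : Fin 3 → ZMod 2) : (e.symm u : Ygrp n) + p ≠ e.symm v + q :=
    fun h => hpq (hne u v hp hq h).2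
  have h₂ (u v : Fin 3 → ZMod 2) : (e.symm u : Ygrp n) + p ≠ e.symm v + r :=
    fun h => hpr (hne u v hp hr h).2
  have h₃ (u v : Fin 3 → ZMod 2) : (e.symm u : Ygrp n) + q ≠ e.symm v + r :=
    fun h => hqr (hne u v hq hr h).2
  refine ⟨fun i => {(e.symm (f i) : Ygrp n) + p, (e.symm (σ (f i)) : Ygrp n) + q,
    (e.symm (τ (f i)) : Ygrp n) + r}, fun i j hij => ?_, fun i x hx => ?_, fun i => ?_,
    fun i => ?_⟩
  · rw [Finset.disjoint_left]
    intro x hx hy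
    simp only [Finset.mem_insert, Finset.mem_singleton] at hx hy
    rcases hx with rfl | rfl | rfl <;> rcases hy with h | h | h
    · exact hij (f.injective (hne _ _ hp hp h).1)
    · exact h₁ _ _ h
    · exact h₂ _ _ h
    · exact h₁ _ _ h.symm
    · exact hij (f.injective (hσ (hne _ _ hq hq h).1))
    · exact h₃ _ _ h
    · exact h₂ _ _ h.symm
    · exact h₃ _ _ h.symm
    · exact hij (f.injective (hτ (hne _ _ hr hr h).1))
  · simp only [Finset.coe_insert, Finset.coe_singleton, Set.mem_insert_iff,
      Set.mem_singleton_iff] at hx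
    rcases hx with rfl | rfl | rfl
    · exact Set.add_mem_add (e.symm _).2 hp
    · exact Set.add_mem_add (e.symm _).2 hq
    · exact Set.add_mem_add (e.symm _).2 hr
  · exact Finset.card_eq_three.mpr ⟨_, _, _, h₁ _ _, h₂ _ _, h₃ _ _, rfl⟩
  · rw [Finset.sum_insert (by simp only [Finset.mem_insert, Finset.mem_singleton, h₁, h₂, or_self,
      not_false_eq_true]), Finset.sum_pair (h₃ _ _)]
    have hW0 : (e.symm (f i) : Ygrp n) + e.symm (σ (f i)) + e.symm (τ (f i)) = 0 := by
      rw [← AddSubgroup.coe_add, ← AddSubgroup.coe_add, ← map_add, ← map_add, hsum, map_zero,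
        AddSubgroup.coe_zero]
    calc _ = ((e.symm (f i) : Ygrp n) + e.symm (σ (f i)) + e.symm (τ (f i))) + (p + q + r) := by
          abel
      _ = 0 := by rw [hW0, hpqr, add_zero]
end

section
/- Let n ≥ 3 be an integer and let Y = Z_4 × (Z_2)^{n−2}. Let W be a subgroup of Y isomorphic to (Z_2)^3 and let R be a zero-sum subset of Y of cardinality 5 such that W ∩ ⟨R⟩ = {0}, where ⟨R⟩ is the subgroup of Y generated by R. Then there exists a family of 8 pairwise disjoint zero-sum subsets of the sumset W + R = {w + r : w ∈ W, r ∈ R}, each of cardinality 5. -/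
open Pointwise

/-- An element of `W + R` determines its `W`-part and its `R`-part as soon as `W` meets the
subgroup generated by `R` trivially. -/
theorem AddSubgroup.add_eq_add_iff_of_inf_closure_eq_bot {G : Type*} [AddCommGroup G]
    {W : AddSubgroup G} {R : Set G} (hWR : W ⊓ AddSubgroup.closure R = ⊥)
    {w w' r r' : G} (hw : w ∈ W) (hw' : w' ∈ W) (hr : r ∈ R) (hr' : r' ∈ R) :
    w + r = w' + r' ↔ w = w' ∧ r = r' := by
  refine ⟨fun h => ?_, by rintro ⟨rfl, rfl⟩; rfl⟩
  have hd : w - w' = r' - r := by rw [sub_eq_sub_iff_add_eq_add, h, add_comm]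
  have hmem : w - w' ∈ W ⊓ AddSubgroup.closure R :=
    ⟨W.sub_mem hw hw', hd ▸ (AddSubgroup.closure R).sub_mem
      (AddSubgroup.subset_closure hr') (AddSubgroup.subset_closure hr)⟩
  rw [hWR, AddSubgroup.mem_bot] at hmem
  exact ⟨sub_eq_zero.mp hmem, (sub_eq_zero.mp (hd ▸ hmem)).symm⟩

/-- If a group `V` isomorphic to `W` has self-injections `φ r`, one for each `r` in the zero-sum
set `R`, that add up to zero, then `W + R` contains disjoint zero-sum copies of `R` indexed
by `V`. -/
theorem exists_disjoint_zero_sum_of_sum_injective_eq_zero {G V ι : Type*} [AddCommGroup G]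
    [AddCommGroup V] [Fintype ι] (W : AddSubgroup G) (e : W ≃+ V) (R : Finset G)
    (r : ι ≃ R) (hRsum : ∑ x ∈ R, x = 0)
    (hWR : W ⊓ AddSubgroup.closure (R : Set G) = ⊥)
    (φ : ι → V → V) (hφ : ∀ j, Function.Injective (φ j)) (hφsum : ∀ v, ∑ j, φ j v = 0) :
    ∃ F : V → Finset G,
      (∀ v v', v ≠ v' → Disjoint (F v) (F v')) ∧
      (∀ v, (F v : Set G) ⊆ (W : Set G) + (R : Set G)) ∧
      (∀ v, (F v).card = R.card) ∧
      (∀ v, ∑ x ∈ F v, x = 0) := by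
  classical
  let f (v : V) (j : ι) : G := (e.symm (φ j v) : G) + (r j : G)
  have key {v v' : V} {j j' : ι} (h : f v j = f v' j') : v = v' ∧ j = j' := by
    obtain ⟨hw, hr⟩ := (AddSubgroup.add_eq_add_iff_of_inf_closure_eq_bot hWR
      (e.symm (φ j v)).2 (e.symm (φ j' v')).2 (r j).2 (r j').2).mp h
    obtain rfl : j = j' := r.injective (Subtype.ext hr)
    exact ⟨hφ j (e.symm.injective (Subtype.ext hw)), rfl⟩
  have hinj (v : V) : Function.Injective (f v) := fun _ _ h => (key h).2
  refine ⟨fun v => Finset.univ.image (f v), fun v v' hv => ?_, fun v x hx => ?_, fun v => ?_,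
    fun v => ?_⟩
  · simp only [Finset.disjoint_left, Finset.mem_image, Finset.mem_univ, true_and]
    rintro _ ⟨j, rfl⟩ ⟨j', h⟩
    exact hv (key h).1.symm
  · obtain ⟨j, -, rfl⟩ := Finset.mem_image.mp (Finset.mem_coe.mp hx)
    exact Set.add_mem_add (e.symm (φ j v)).2 (r j).2
  · rw [Finset.card_image_of_injective _ (hinj v), Finset.card_univ, Fintype.card_congr r,
      Fintype.card_coe]
  · rw [Finset.sum_image fun _ _ _ _ h => hinj v h, Finset.sum_add_distrib,
      r.sum_comp (fun x : R => (x : G)), Finset.sum_coe_sort R (fun x => x), hRsum, add_zero,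
      ← AddSubgroup.val_finsetSum, ← map_sum, hφsum, map_zero, AddSubgroup.coe_zero]

/-- Five bijective linear maps of `(Z_2)^3` with sum zero: three times the identity, the companion
map `A` of the irreducible polynomial `t ^ 3 + t + 1`, and `A + 1`. -/
def zeroSumMaps : Fin 5 → (Fin 3 → ZMod 2) → (Fin 3 → ZMod 2) :=
  ![id, id, id, fun x => ![x 2, x 0 + x 2, x 1],
    fun x => ![x 0 + x 2, x 0 + x 1 + x 2, x 1 + x 2]]

theorem zeroSumMaps_injective : ∀ j, Function.Injective (zeroSumMaps j) := by
  decide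

theorem sum_zeroSumMaps : ∀ v, ∑ j, zeroSumMaps j v = 0 := by
  decide

/-- if `W ≤ Y = Z_4 × (Z_2)^(n-2)` is a subgroup isomorphic to `(Z_2)^3`
and `R` is a zero-sum 5-subset of `Y` with `W ∩ ⟨R⟩ = {0}`, then `(0,0,8)` is
realizable in the sumset `W + R`: there are 8 pairwise disjoint zero-sum subsets of
`W + R`, each of cardinality 5. -/
theorem realizable_eight_quintuples_in_sumset (n : ℕ) (hn : 3 ≤ n)
    (W : AddSubgroup (Ygrp n)) (hW : Nonempty (W ≃+ (Fin 3 → ZMod 2)))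
    (R : Finset (Ygrp n)) (hRcard : R.card = 5) (hRsum : ∑ x ∈ R, x = 0)
    (hWR : W ⊓ AddSubgroup.closure (R : Set (Ygrp n)) = ⊥) :
    ∃ F : Fin 8 → Finset (Ygrp n),
      (∀ i j, i ≠ j → Disjoint (F i) (F j)) ∧
      (∀ i, (↑(F i) : Set (Ygrp n)) ⊆ (W : Set (Ygrp n)) + (R : Set (Ygrp n))) ∧
      (∀ i, (F i).card = 5) ∧
      (∀ i, ∑ x ∈ F i, x = 0) := by
  obtain ⟨e⟩ := hW
  obtain ⟨F, hdisj, hsub, hcard, hsum⟩ := exists_disjoint_zero_sum_of_sum_injective_eq_zero W e R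
    (R.equivFinOfCardEq hRcard).symm hRsum hWR zeroSumMaps zeroSumMaps_injective sum_zeroSumMaps
  have g : Fin 8 ≃ (Fin 3 → ZMod 2) := (Fintype.equivFinOfCardEq (by simp)).symm
  exact ⟨F ∘ g, fun i j hij => hdisj _ _ (g.injective.ne hij), fun i => hsub _,
    fun i => (hcard _).trans hRcard, fun i => hsum _⟩
end

section
/- Let r be a nonnegative integer and let a, b, c be nonnegative integers such that 3a + 4b + 5c ≥ 45r + 12 and ⌈(b − 1)/9⌉ ≤ a/3 + c (the latter inequality taken in the rationals, with ⌈·⌉ the ceiling). Then there exist nonnegative integers x_1, …, x_r, y_1, …, y_r, z_1, …, z_r such that 3x_i + 4y_i + 5z_i = 45 for all i, 1 ≤ i ≤ r, and x_1 + ⋯ + x_r ≤ a, y_1 + ⋯ + y_r ≤ b, and z_1 + ⋯ + z_r ≤ c. -/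
/-- A triple of small capacities of total weight at least `57` contains a block of weight `45`. -/
lemma exists_block_of_le_nine {a b c : ℕ} (hb : b ≤ 9) (h : 57 ≤ 3 * a + 4 * b + 5 * c) :
    ∃ x y z : ℕ, 3 * x + 4 * y + 5 * z = 45 ∧ x ≤ a ∧ y ≤ b ∧ z ≤ c := by
  by_cases ha : 15 ≤ a
  · exact ⟨15, 0, 0, by norm_num, ha, b.zero_le, c.zero_le⟩
  by_cases hc : 9 ≤ c
  · exact ⟨0, 0, 9, by norm_num, a.zero_le, b.zero_le, hc⟩
  have key : ∀ (b : Fin 10) (c : Fin 9) (a : Fin 15), 57 ≤ 3 * a.val + 4 * b.val + 5 * c.val →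
      ∃ (x : Fin (a.val + 1)) (y : Fin (b.val + 1)) (z : Fin (c.val + 1)),
        3 * x.val + 4 * y.val + 5 * z.val = 45 := by
    decide +kernel
  obtain ⟨x, y, z, h45⟩ := key ⟨b, by omega⟩ ⟨c, by omega⟩ ⟨a, by omega⟩ h
  exact ⟨x, y, z, h45, Nat.lt_succ_iff.mp x.isLt, Nat.lt_succ_iff.mp y.isLt,
    Nat.lt_succ_iff.mp z.isLt⟩

/-- A block of weight `45` can be removed so that the balance condition survives as long as
the remaining weight is at least `57`. -/
lemma exists_block {a b c : ℕ} (h : 57 ≤ 3 * a + 4 * b + 5 * c)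
    (hbal : 3 * ((b + 7) / 9) ≤ a + 3 * c) :
    ∃ x y z : ℕ, 3 * x + 4 * y + 5 * z = 45 ∧ x ≤ a ∧ y ≤ b ∧ z ≤ c ∧
      (57 ≤ 3 * (a - x) + 4 * (b - y) + 5 * (c - z) →
        3 * ((b - y + 7) / 9) ≤ (a - x) + 3 * (c - z)) := by
  by_cases hb : b ≤ 9
  · obtain ⟨x, y, z, h45, hx, hy, hz⟩ := exists_block_of_le_nine hb h
    exact ⟨x, y, z, h45, hx, hy, hz, by omega⟩
  by_cases ha : 3 ≤ a
  · exact ⟨3, 9, 0, by norm_num, ha, by omega, by omega, by omega⟩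
  · exact ⟨0, 10, 1, by norm_num, by omega, by omega, by omega, by omega⟩

/-- The splitting result with the balance condition expressed in natural numbers. -/
lemma exists_split_of_balanced (r a b c : ℕ) (h : 45 * r + 12 ≤ 3 * a + 4 * b + 5 * c)
    (hbal : 0 < r → 3 * ((b + 7) / 9) ≤ a + 3 * c) :
    ∃ x y z : Fin r → ℕ,
      (∀ i, 3 * x i + 4 * y i + 5 * z i = 45) ∧
      (∑ i, x i) ≤ a ∧ (∑ i, y i) ≤ b ∧ (∑ i, z i) ≤ c := by
  induction r generalizing a b c with
  | zero => exact ⟨0, 0, 0, fun i => i.elim0, by simp, by simp, by simp⟩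
  | succ r ih =>
    obtain ⟨x, y, z, h45, hx, hy, hz, hrest⟩ := exists_block (by omega) (hbal r.succ_pos)
    obtain ⟨xs, ys, zs, hs, hxs, hys, hzs⟩ :=
      ih (a - x) (b - y) (c - z) (by omega) (fun hr => hrest (by omega))
    refine ⟨Fin.cons x xs, Fin.cons y ys, Fin.cons z zs, Fin.cases h45 hs, ?_, ?_, ?_⟩ <;>
      simp only [Fin.sum_univ_succ, Fin.cons_zero, Fin.cons_succ] <;> omega

/-- Egawa's numerical lemma: if `3a + 4b + 5c ≥ 45r + 12` and
`⌈(b-1)/9⌉ ≤ a/3 + c` (in the rationals), then there are nonnegative integers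
`x_i, y_i, z_i` (`1 ≤ i ≤ r`) with `3x_i + 4y_i + 5z_i = 45` for all `i` and
`∑ x_i ≤ a`, `∑ y_i ≤ b`, `∑ z_i ≤ c`. -/
theorem exists_split_fortyfive (r a b c : ℕ)
    (h1 : 45 * r + 12 ≤ 3 * a + 4 * b + 5 * c)
    (h2 : (⌈((b : ℚ) - 1) / 9⌉ : ℚ) ≤ (a : ℚ) / 3 + (c : ℚ)) :
    ∃ x y z : Fin r → ℕ,
      (∀ i, 3 * x i + 4 * y i + 5 * z i = 45) ∧
      (∑ i, x i) ≤ a ∧ (∑ i, y i) ≤ b ∧ (∑ i, z i) ≤ c := by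
  refine exists_split_of_balanced r a b c h1 fun _ => ?_
  have hceil : (((b + 7) / 9 : ℕ) : ℤ) ≤ ⌈((b : ℚ) - 1) / 9⌉ := by
    have h : ((b : ℚ) - 1) / 9 ≤ (⌈((b : ℚ) - 1) / 9⌉ : ℚ) := Int.le_ceil _
    rw [div_le_iff₀ (by norm_num)] at h
    have h' : (b : ℤ) - 1 ≤ ⌈((b : ℚ) - 1) / 9⌉ * 9 := by exact_mod_cast h
    omega
  have h3 : (3 : ℚ) * ⌈((b : ℚ) - 1) / 9⌉ ≤ a + 3 * c := by linarith
  have h4 : 3 * ⌈((b : ℚ) - 1) / 9⌉ ≤ (a : ℤ) + 3 * c := by exact_mod_cast h3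
  omega
end

section
/- Let Γ be a finite Abelian group of order m. Suppose that for all nonnegative integers a, b, c with 3a + 4b + 5c = m − 1, the set Γ \ {0} can be partitioned into pairwise disjoint zero-sum subsets consisting of exactly a subsets of cardinality 3, b subsets of cardinality 4, and c subsets of cardinality 5. Then for every positive integer t and all integers m_1, …, m_t with m_i ≥ 3 for every i and m_1 + ⋯ + m_t = m − 1, there exists a partition of Γ \ {0} into pairwise disjoint subsets S_1, …, S_t such that |S_i| = m_i and the sum of the elements of S_i equals 0 for every i. -/
/-- A finset whose cardinality is `∑ i, n i` can be coloured so that colour `i` occurs exactly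
`n i` times. -/
theorem Finset.exists_coloring_card_filter_eq {α ι : Type*} [Fintype ι] [DecidableEq ι]
    [Nonempty ι] (Q : Finset α) (n : ι → ℕ) (h : Q.card = ∑ i, n i) :
    ∃ f : α → ι, ∀ i, (Q.filter (fun x => f x = i)).card = n i := by
  classical
  have e : Q ≃ Σ i, Fin (n i) := Fintype.equivOfCardEq (by simp [h])
  refine ⟨fun x => if hx : x ∈ Q then (e ⟨x, hx⟩).1 else Classical.arbitrary ι, fun i => ?_⟩
  rw [← Fintype.card_fin (n i), ← Finset.card_univ]
  symm
  refine Finset.card_bij (fun j _ => (e.symm ⟨i, j⟩ : α)) ?_ ?_ ?_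
  · intro j _
    simp
  · intro j _ k _ hjk
    simpa using hjk
  · intro x hx
    obtain ⟨hxQ, hxi⟩ := Finset.mem_filter.1 hx
    simp only [dif_pos hxQ] at hxi
    subst hxi
    exact ⟨(e ⟨x, hxQ⟩).2, Finset.mem_univ _, by simp⟩

theorem Nat.exists_eq_three_mul_add_four_mul_add_five_mul {n : ℕ} (hn : 3 ≤ n) :
    ∃ a b c : ℕ, n = 3 * a + 4 * b + 5 * c := by
  obtain h | h | h : n % 3 = 0 ∨ n % 3 = 1 ∨ n % 3 = 2 := by omega
  · exact ⟨n / 3, 0, 0, by omega⟩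
  · exact ⟨n / 3 - 1, 1, 0, by omega⟩
  · exact ⟨n / 3 - 1, 0, 1, by omega⟩

/-- if all triples `(a,b,c)` with `3a + 4b + 5c = m - 1` are realizable
as zero-sum partitions of `Γ \ {0}` (with `a` parts of size 3, `b` of size 4, `c` of
size 5), then `Γ` has the 3-Zero-Sum Partition Property. -/
theorem three_zsp_of_realizable_triples {Γ : Type*} [AddCommGroup Γ] [Fintype Γ]
    [DecidableEq Γ] (m : ℕ) (hm : Fintype.card Γ = m)
    (hreal : ∀ a b c : ℕ, 3 * a + 4 * b + 5 * c = m - 1 →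
      ∃ P : Finset (Finset Γ),
        (∀ s ∈ P, ∀ t ∈ P, s ≠ t → Disjoint s t) ∧
        P.biUnion id = Finset.univ \ {0} ∧
        (∀ s ∈ P, ∑ x ∈ s, x = 0) ∧
        (∀ s ∈ P, s.card = 3 ∨ s.card = 4 ∨ s.card = 5) ∧
        (P.filter (fun s => s.card = 3)).card = a ∧
        (P.filter (fun s => s.card = 4)).card = b ∧
        (P.filter (fun s => s.card = 5)).card = c) :
    ∀ t : ℕ, 0 < t → ∀ ms : Fin t → ℕ, (∀ i, 3 ≤ ms i) → ∑ i, ms i = m - 1 →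
      ∃ S : Fin t → Finset Γ,
        (∀ i j, i ≠ j → Disjoint (S i) (S j)) ∧
        Finset.univ.biUnion S = Finset.univ \ {0} ∧
        (∀ i, (S i).card = ms i) ∧
        (∀ i, ∑ x ∈ S i, x = 0) := by
  intro t ht ms hms hsum
  have : Nonempty (Fin t) := ⟨⟨0, ht⟩⟩
  choose a b c habc using fun i => Nat.exists_eq_three_mul_add_four_mul_add_five_mul (hms i)
  obtain ⟨P, hdisj, hcover, hzero, hsize, h3, h4, h5⟩ :=
    hreal (∑ i, a i) (∑ i, b i) (∑ i, c i) (by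
      rw [← hsum, Finset.mul_sum, Finset.mul_sum, Finset.mul_sum, ← Finset.sum_add_distrib,
        ← Finset.sum_add_distrib]
      exact Finset.sum_congr rfl fun i _ => (habc i).symm)
  obtain ⟨f, hf⟩ := Finset.exists_coloring_card_filter_eq _ a h3
  obtain ⟨g, hg⟩ := Finset.exists_coloring_card_filter_eq _ b h4
  obtain ⟨h, hh⟩ := Finset.exists_coloring_card_filter_eq _ c h5
  let col : Finset Γ → Fin t := fun s =>
    if s.card = 3 then f s else if s.card = 4 then g s else h s
  have hpair : ∀ i, ((P.filter (fun s => col s = i) : Finset (Finset Γ)) :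
      Set (Finset Γ)).PairwiseDisjoint id := fun i s hs u hu hsu =>
    hdisj s (Finset.mem_filter.1 hs).1 u (Finset.mem_filter.1 hu).1 hsu
  refine ⟨fun i => (P.filter (fun s => col s = i)).biUnion id, ?_, ?_, ?_, ?_⟩
  · intro i j hij
    simp only [Finset.disjoint_biUnion_left, Finset.disjoint_biUnion_right, Finset.mem_filter]
    rintro s ⟨hs, rfl⟩ u ⟨hu, rfl⟩
    exact hdisj _ hu _ hs fun hsu => hij (congrArg col hsu)
  · rw [← hcover]
    ext x
    simp
  · intro i
    have key : ∀ (k : ℕ) (q : Finset Γ → Fin t), (∀ s, s.card = k → col s = q s) →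
        ∑ s ∈ P.filter (fun s => col s = i) with s.card = k, s.card =
          k * (((P.filter (fun s => s.card = k)).filter (fun s => q s = i)).card) := by
      intro k q hq
      rw [Finset.sum_congr rfl fun s hs => (Finset.mem_filter.1 hs).2, Finset.sum_const,
        smul_eq_mul, mul_comm, Finset.filter_comm]
      congr 2
      exact Finset.filter_congr fun s hs => by rw [hq s (Finset.mem_filter.1 hs).2]
    rw [Finset.card_biUnion (hpair i)]
    simp only [id]
    rw [← Finset.sum_fiberwise_of_maps_to (g := Finset.card) (t := {3, 4, 5})
      (fun s hs => by simpa using hsize s (Finset.mem_filter.1 hs).1)]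
    rw [Finset.sum_insert (by simp), Finset.sum_insert (by simp), Finset.sum_singleton,
      key 3 f (fun s hs => by simp [col, hs]), key 4 g (fun s hs => by simp [col, hs]),
      key 5 h (fun s hs => by simp [col, hs]), hf, hg, hh, habc i, add_assoc]
  · intro i
    rw [Finset.sum_biUnion (hpair i)]
    exact Finset.sum_eq_zero fun s hs => hzero s (Finset.mem_filter.1 hs).1
end

section
/- For all nonnegative integers a, b, c with 3a + 4b + 5c = 31, the set of nonzero elements of the group Z_4 × Z_2 × Z_2 × Z_2 can be partitioned into pairwise disjoint zero-sum subsets consisting of exactly a subsets of cardinality 3, b subsets of cardinality 4, and c subsets of cardinality 5. -/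
/-- The element `(w, x, y, z)` encoded by the number `n = 8 * w + 4 * x + 2 * y + z`. -/
def decodeElement (n : ℕ) : ZMod 4 × ZMod 2 × ZMod 2 × ZMod 2 :=
  ((n / 8 : ℕ), (n / 4 : ℕ), (n / 2 : ℕ), n)

theorem nodup_map_decodeElement_range' :
    ((List.range' 1 31).map decodeElement).Nodup := by
  decide +kernel

theorem toFinset_map_decodeElement_range' :
    ((List.range' 1 31).map decodeElement).toFinset = Finset.univ \ {0} := by
  decide +kernel

/-- `P` is a partition of `S` into zero-sum subsets, namely `a` of cardinality 3, `b` of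
cardinality 4 and `c` of cardinality 5. -/
def IsZeroSumPartition {G : Type*} [AddCommMonoid G] [DecidableEq G] (S : Finset G)
    (P : Finset (Finset G)) (a b c : ℕ) : Prop :=
  (∀ s ∈ P, ∀ t ∈ P, s ≠ t → Disjoint s t) ∧
  P.biUnion id = S ∧
  (∀ s ∈ P, ∑ x ∈ s, x = 0) ∧
  (∀ s ∈ P, s.card = 3 ∨ s.card = 4 ∨ s.card = 5) ∧
  (P.filter (fun s => s.card = 3)).card = a ∧
  (P.filter (fun s => s.card = 4)).card = b ∧
  (P.filter (fun s => s.card = 5)).card = c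

theorem isZeroSumPartition_toFinset {G : Type*} [AddCommMonoid G] [DecidableEq G]
    (L : List (List G)) (hnodup : L.flatten.Nodup) (hsum : ∀ l ∈ L, l.sum = 0)
    (hlength : ∀ l ∈ L, l.length = 3 ∨ l.length = 4 ∨ l.length = 5) :
    IsZeroSumPartition L.flatten.toFinset (L.map List.toFinset).toFinset
      ((L.map List.length).count 3) ((L.map List.length).count 4)
      ((L.map List.length).count 5) := by
  obtain ⟨hl, hpair⟩ := List.nodup_flatten.mp hnodup
  have hcard : ∀ l ∈ L, l.toFinset.card = l.length := fun l h =>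
    List.toFinset_card_of_nodup (hl l h)
  have hdisj : (L.map List.toFinset).Pairwise Disjoint :=
    List.pairwise_map.mpr (hpair.imp fun h => List.disjoint_toFinset_iff_disjoint.mpr h)
  have hnodup' : (L.map List.toFinset).Nodup := by
    refine hdisj.imp_of_mem fun {s t} hs _ hst heq => ?_
    obtain ⟨l, h, rfl⟩ := List.mem_map.mp hs
    have hempty : l.toFinset = ∅ := by simpa [← heq] using hst
    have := hcard l h
    have := hlength l h
    simp only [hempty, Finset.card_empty] at *
    omega
  have hcount (k : ℕ) : ((L.map List.toFinset).toFinset.filter (fun s => s.card = k)).card =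
      (L.map List.length).count k := by
    have hfilter : (L.map List.toFinset).toFinset.filter (fun s => s.card = k) =
        ((L.map List.toFinset).filter (fun s => s.card = k)).toFinset := by
      simp [List.toFinset_filter]
    rw [hfilter, List.toFinset_card_of_nodup (hnodup'.filter _),
      ← List.countP_eq_length_filter, List.countP_map, List.count, List.countP_map]
    refine List.countP_congr fun l h => ?_
    simp [hcard l h]
  refine ⟨?_, ?_, ?_, ?_, hcount 3, hcount 4, hcount 5⟩
  · intro s hs t ht hst
    exact hdisj.forall (List.mem_toFinset.mp hs) (List.mem_toFinset.mp ht) hst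
  · ext x
    simp
  · intro s hs
    obtain ⟨l, h, rfl⟩ := List.mem_map.mp (List.mem_toFinset.mp hs)
    rw [List.sum_toFinset _ (hl l h), List.map_id', hsum l h]
  · intro s hs
    obtain ⟨l, h, rfl⟩ := List.mem_map.mp (List.mem_toFinset.mp hs)
    rw [hcard l h]
    exact hlength l h

theorem exists_isZeroSumPartition (L : List (List ℕ)) (hperm : L.flatten.Perm (List.range' 1 31))
    (hsum : ∀ l ∈ L, (l.map decodeElement).sum = 0)
    (hlength : ∀ l ∈ L, l.length = 3 ∨ l.length = 4 ∨ l.length = 5) :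
    ∃ P : Finset (Finset (ZMod 4 × ZMod 2 × ZMod 2 × ZMod 2)),
      IsZeroSumPartition (Finset.univ \ {0}) P ((L.map List.length).count 3)
        ((L.map List.length).count 4) ((L.map List.length).count 5) := by
  have hperm' : (L.map (List.map decodeElement)).flatten.Perm
      ((List.range' 1 31).map decodeElement) := by
    rw [← List.map_flatten]
    exact hperm.map _
  have h := isZeroSumPartition_toFinset (L.map (List.map decodeElement))
    (hperm'.nodup_iff.mpr nodup_map_decodeElement_range') (by simpa using hsum)
    (by simpa using hlength)
  rw [List.toFinset_eq_of_perm _ _ hperm', toFinset_map_decodeElement_range'] at h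
  simp only [List.map_map, Function.comp_def, List.length_map] at h
  exact ⟨_, h⟩

theorem solutions_three_four_five_eq :
    (Finset.range 11 ×ˢ Finset.range 8 ×ˢ Finset.range 7).filter
      (fun t => 3 * t.1 + 4 * t.2.1 + 5 * t.2.2 = 31) =
    {(9, 1, 0), (5, 4, 0), (1, 7, 0), (6, 2, 1), (2, 5, 1), (7, 0, 2), (3, 3, 2), (4, 1, 3),
      (0, 4, 3), (1, 2, 4), (2, 0, 5)} := by
  decide +kernel

/-- for all nonnegative a, b, c with 3a + 4b + 5c as hypothesized, the nonzero
elements of `ZMod 4 × ZMod 2 × ZMod 2 × ZMod 2` can be partitioned into pairwise disjoint zero-sum subsets: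
exactly a subsets of cardinality 3, b of cardinality 4 and c of cardinality 5. -/
theorem realizable_in_Z4_Z2_Z2_Z2 (a b c : ℕ) (habc : 3 * a + 4 * b + 5 * c = 31) :
    ∃ P : Finset (Finset (ZMod 4 × ZMod 2 × ZMod 2 × ZMod 2)),
      (∀ s ∈ P, ∀ t ∈ P, s ≠ t → Disjoint s t) ∧
      P.biUnion id = Finset.univ \ {0} ∧
      (∀ s ∈ P, ∑ x ∈ s, x = 0) ∧
      (∀ s ∈ P, s.card = 3 ∨ s.card = 4 ∨ s.card = 5) ∧
      (P.filter (fun s => s.card = 3)).card = a ∧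
      (P.filter (fun s => s.card = 4)).card = b ∧
      (P.filter (fun s => s.card = 5)).card = c := by
  have solution : (a, b, c) ∈ (Finset.range 11 ×ˢ Finset.range 8 ×ˢ Finset.range 7).filter
      (fun t => 3 * t.1 + 4 * t.2.1 + 5 * t.2.2 = 31) := by
    simp only [Finset.mem_filter, Finset.mem_product, Finset.mem_range]
    omega
  simp only [solutions_three_four_five_eq, Finset.mem_insert, Finset.mem_singleton,
    Prod.mk.injEq] at solution
  rcases solution with
    ⟨rfl, rfl, rfl⟩ | ⟨rfl, rfl, rfl⟩ | ⟨rfl, rfl, rfl⟩ | ⟨rfl, rfl, rfl⟩ |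
    ⟨rfl, rfl, rfl⟩ | ⟨rfl, rfl, rfl⟩ | ⟨rfl, rfl, rfl⟩ | ⟨rfl, rfl, rfl⟩ |
    ⟨rfl, rfl, rfl⟩ | ⟨rfl, rfl, rfl⟩ | ⟨rfl, rfl, rfl⟩
  · exact exists_isZeroSumPartition [[6, 18, 20], [12, 13, 17], [7, 11, 28], [2, 9, 27],
        [8, 14, 22], [3, 10, 25], [1, 15, 30], [5, 16, 21], [4, 19, 23], [24, 26, 29, 31]]
      (by decide +kernel) (by decide +kernel) (by decide +kernel)
  · exact exists_isZeroSumPartition [[6, 19, 21], [18, 24, 26], [8, 9, 17], [5, 10, 31],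
        [3, 20, 23], [11, 14, 25, 28], [2, 4, 13, 27], [1, 7, 16, 22], [12, 15, 29, 30]]
      (by decide +kernel) (by decide +kernel) (by decide +kernel)
  · exact exists_isZeroSumPartition [[8, 11, 19], [7, 18, 26, 31], [1, 20, 25, 28],
        [4, 5, 15, 30], [2, 17, 24, 27], [6, 12, 13, 23], [14, 21, 22, 29], [3, 9, 10, 16]]
      (by decide +kernel) (by decide +kernel) (by decide +kernel)
  · exact exists_isZeroSumPartition [[13, 15, 18], [1, 9, 24], [7, 19, 20], [6, 17, 23],
        [8, 14, 22], [5, 12, 25], [26, 27, 30, 31], [4, 10, 11, 21], [2, 3, 16, 28, 29]]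
      (by decide +kernel) (by decide +kernel) (by decide +kernel)
  · exact exists_isZeroSumPartition [[1, 14, 31], [2, 5, 7], [26, 27, 28, 29], [9, 16, 23, 30],
        [12, 17, 20, 25], [6, 10, 15, 19], [3, 8, 13, 22], [4, 11, 18, 21, 24]]
      (by decide +kernel) (by decide +kernel) (by decide +kernel)
  · exact exists_isZeroSumPartition [[9, 15, 22], [17, 26, 27], [12, 14, 18], [20, 24, 28],
        [7, 10, 29], [23, 25, 30], [4, 11, 31], [1, 2, 5, 19, 21], [3, 6, 8, 13, 16]]
      (by decide +kernel) (by decide +kernel) (by decide +kernel)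
  · exact exists_isZeroSumPartition [[5, 12, 25], [4, 9, 29], [7, 18, 21], [6, 16, 24, 30],
        [2, 8, 13, 23], [10, 11, 26, 27], [17, 20, 22, 28, 31], [1, 3, 14, 15, 19]]
      (by decide +kernel) (by decide +kernel) (by decide +kernel)
  · exact exists_isZeroSumPartition [[12, 14, 18], [6, 16, 22], [1, 2, 3], [5, 15, 26],
        [9, 13, 27, 31], [8, 23, 28, 29, 30], [4, 11, 19, 21, 25], [7, 10, 17, 20, 24]]
      (by decide +kernel) (by decide +kernel) (by decide +kernel)
  · exact exists_isZeroSumPartition [[7, 19, 24, 28], [9, 11, 13, 15], [5, 8, 12, 17],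
        [1, 4, 18, 23], [2, 3, 16, 30, 31], [10, 22, 26, 27, 29], [6, 14, 20, 21, 25]]
      (by decide +kernel) (by decide +kernel) (by decide +kernel)
  · exact exists_isZeroSumPartition [[2, 4, 6], [8, 9, 10, 11], [14, 20, 21, 31],
        [5, 24, 26, 27, 28], [7, 12, 17, 19, 25], [1, 13, 15, 29, 30], [3, 16, 18, 22, 23]]
      (by decide +kernel) (by decide +kernel) (by decide +kernel)
  · exact exists_isZeroSumPartition [[11, 13, 22], [18, 28, 30], [1, 14, 17, 20, 26],
        [4, 6, 9, 12, 23], [5, 8, 15, 29, 31], [3, 7, 21, 24, 25], [2, 10, 16, 19, 27]]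
      (by decide +kernel) (by decide +kernel) (by decide +kernel)
end

section
/- For all nonnegative integers a, b, c with 3a + 4b + 5c = 31, the set of nonzero elements of the group Z_4 × Z_4 × Z_2 can be partitioned into pairwise disjoint zero-sum subsets consisting of exactly a subsets of cardinality 3, b subsets of cardinality 4, and c subsets of cardinality 5. -/
/-- Disjoint lists without repetitions, nonempty and each of sum zero, give a family of pairwise
disjoint zero-sum sets with the same sizes. -/
theorem exists_zeroSum_partition {G : Type*} [AddCommMonoid G] [DecidableEq G] (M : List (List G))
    (hnodup : M.flatten.Nodup) (hne : ∀ l ∈ M, l ≠ []) (hsum : ∀ l ∈ M, l.sum = 0) :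
    ∃ P : Finset (Finset G),
      (∀ s ∈ P, ∀ t ∈ P, s ≠ t → Disjoint s t) ∧
      P.biUnion id = M.flatten.toFinset ∧
      (∀ s ∈ P, ∑ x ∈ s, x = 0) ∧
      (∀ s ∈ P, ∃ l ∈ M, s.card = l.length) ∧
      ∀ k, (P.filter (fun s => s.card = k)).card = (M.filter (fun l => l.length = k)).length := by
  obtain ⟨hl, hdisj⟩ := List.nodup_flatten.1 hnodup
  have hcard : ∀ l ∈ M, l.toFinset.card = l.length := fun l h =>
    List.toFinset_card_of_nodup (hl l h)
  have hpair : (M.map List.toFinset).Pairwise Disjoint :=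
    List.pairwise_map.2 (hdisj.imp fun h => List.disjoint_toFinset_iff_disjoint.2 h)
  have hmap : (M.map List.toFinset).Nodup := by
    refine List.pairwise_map.2 (hdisj.imp_of_mem fun {l m} hlM _ h heq => hne l hlM ?_)
    have h_self := List.disjoint_toFinset_iff_disjoint.2 h
    rw [← heq, disjoint_self] at h_self
    exact List.toFinset_eq_empty_iff l |>.1 h_self
  refine ⟨(M.map List.toFinset).toFinset, ?_, ?_, ?_, ?_, fun k => ?_⟩
  · intro s hs t ht hst
    exact hpair.forall (List.mem_toFinset.1 hs) (List.mem_toFinset.1 ht) hst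
  · ext x
    simp
  · simp only [List.mem_toFinset, List.mem_map, forall_exists_index, and_imp,
      forall_apply_eq_imp_iff₂]
    intro l h
    rw [List.sum_toFinset _ (hl l h), List.map_id', hsum l h]
  · simp only [List.mem_toFinset, List.mem_map, forall_exists_index, and_imp,
      forall_apply_eq_imp_iff₂]
    exact fun l h => ⟨l, h, hcard l h⟩
  · have hfilter : (M.map List.toFinset).toFinset.filter (fun s => s.card = k) =
        ((M.map List.toFinset).filter (fun s => s.card = k)).toFinset := by
      ext
      simp
    rw [hfilter, List.toFinset_card_of_nodup (hmap.filter _),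
      List.filter_map, List.length_map]
    congr 1
    exact List.filter_congr fun l h => by simp [hcard l h]

/-- The element of `ZMod 4 × ZMod 4 × ZMod 2` with mixed-radix expansion `n`: the numbers below `32`
enumerate the group. -/
def ofMixedRadix (n : ℕ) : ZMod 4 × ZMod 4 × ZMod 2 := ((n / 8 : ℕ), (n / 2 : ℕ), (n : ℕ))

/-- Partitions of the nonzero elements of `ZMod 4 × ZMod 4 × ZMod 2`, listed by their mixed-radix
expansions, into zero-sum blocks: one for each possible choice of the numbers of blocks of sizes
3, 4 and 5. -/
def zeroSumPartitions : List (List (List ℕ)) :=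
  [[[3, 21, 29, 31], [7, 22, 25, 28], [10, 12, 13, 15], [11, 17, 20, 26],
    [1, 8, 18, 23, 24], [2, 6, 9, 14, 19], [4, 5, 16, 27, 30]],
   [[18, 24, 30], [6, 9, 10, 17], [7, 16, 28, 31], [1, 3, 5, 8, 27], [2, 13, 15, 25, 29],
    [4, 20, 21, 22, 23], [11, 12, 14, 19, 26]],
   [[2, 17, 23], [1, 10, 12, 19], [3, 7, 13, 29], [4, 16, 24, 28], [5, 20, 27, 30],
    [6, 9, 14, 21], [8, 15, 25, 26], [11, 18, 22, 31]],
   [[6, 17, 19], [10, 11, 21], [1, 5, 23, 25, 30], [2, 3, 4, 15, 26], [7, 9, 16, 18, 24],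
    [8, 12, 13, 20, 29], [14, 22, 27, 28, 31]],
   [[6, 16, 18], [23, 25, 26], [1, 3, 19, 21], [4, 20, 27, 31], [7, 9, 11, 17],
    [10, 12, 28, 30], [14, 15, 24, 29], [2, 5, 8, 13, 22]],
   [[1, 13, 28], [17, 27, 30], [22, 24, 26], [4, 5, 20, 21], [6, 10, 15, 19],
    [12, 16, 23, 31], [2, 7, 9, 14, 18], [3, 8, 11, 25, 29]],
   [[1, 18, 23], [10, 13, 19], [16, 27, 31], [22, 28, 30], [8, 17, 20, 29],
    [2, 3, 7, 14, 24], [4, 12, 15, 25, 26], [5, 6, 9, 11, 21]],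
   [[2, 16, 22], [5, 10, 27], [6, 8, 26], [9, 13, 20], [21, 24, 29], [1, 18, 25, 30],
    [3, 7, 19, 23], [4, 14, 15, 17], [11, 12, 28, 31]],
   [[3, 16, 23], [4, 12, 24], [5, 9, 28], [6, 11, 25], [13, 15, 22], [21, 30, 31],
    [1, 10, 14, 17], [7, 20, 26, 29], [2, 8, 18, 19, 27]],
   [[4, 11, 27], [5, 6, 7], [8, 9, 17], [10, 14, 16], [13, 15, 22], [19, 24, 31],
    [20, 25, 29], [1, 2, 23, 26, 30], [3, 12, 18, 21, 28]],
   [[2, 12, 26], [3, 16, 23], [4, 9, 29], [6, 20, 22], [7, 10, 25], [8, 13, 21],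
    [11, 14, 17], [18, 24, 30], [19, 27, 28], [1, 5, 15, 31]]]

theorem perm_of_mem_zeroSumPartitions :
    ∀ L ∈ zeroSumPartitions, L.flatten.Perm (List.range' 1 31) := by
  decide +kernel

theorem sum_eq_zero_of_mem_zeroSumPartitions :
    ∀ L ∈ zeroSumPartitions, ∀ l ∈ L, (l.map ofMixedRadix).sum = 0 := by
  decide +kernel

theorem length_of_mem_zeroSumPartitions :
    ∀ L ∈ zeroSumPartitions, ∀ l ∈ L, l.length = 3 ∨ l.length = 4 ∨ l.length = 5 := by
  decide +kernel

theorem exists_mem_zeroSumPartitions :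
    ∀ x ∈ Finset.range 11 ×ˢ Finset.range 8 ×ˢ Finset.range 7,
      3 * x.1 + 4 * x.2.1 + 5 * x.2.2 = 31 → ∃ L ∈ zeroSumPartitions,
        (L.filter (fun l => l.length = 3)).length = x.1 ∧
        (L.filter (fun l => l.length = 4)).length = x.2.1 ∧
        (L.filter (fun l => l.length = 5)).length = x.2.2 := by
  decide +kernel

theorem nodup_map_ofMixedRadix : ((List.range' 1 31).map ofMixedRadix).Nodup := by
  decide +kernel

theorem toFinset_map_ofMixedRadix :
    ((List.range' 1 31).map ofMixedRadix).toFinset = Finset.univ \ {0} := by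
  decide +kernel

/-- for all nonnegative a, b, c with 3a + 4b + 5c as hypothesized, the nonzero
elements of `ZMod 4 × ZMod 4 × ZMod 2` can be partitioned into pairwise disjoint zero-sum subsets:
exactly a subsets of cardinality 3, b of cardinality 4 and c of cardinality 5. -/
theorem realizable_in_Z4_Z4_Z2 (a b c : ℕ) (habc : 3 * a + 4 * b + 5 * c = 31) :
    ∃ P : Finset (Finset (ZMod 4 × ZMod 4 × ZMod 2)),
      (∀ s ∈ P, ∀ t ∈ P, s ≠ t → Disjoint s t) ∧
      P.biUnion id = Finset.univ \ {0} ∧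
      (∀ s ∈ P, ∑ x ∈ s, x = 0) ∧
      (∀ s ∈ P, s.card = 3 ∨ s.card = 4 ∨ s.card = 5) ∧
      (P.filter (fun s => s.card = 3)).card = a ∧
      (P.filter (fun s => s.card = 4)).card = b ∧
      (P.filter (fun s => s.card = 5)).card = c := by
  obtain ⟨L, hL, h3, h4, h5⟩ := exists_mem_zeroSumPartitions (a, b, c)
    (by simp only [Finset.mem_product, Finset.mem_range]; omega) habc
  have hlen := length_of_mem_zeroSumPartitions L hL
  have hperm : (L.map (List.map ofMixedRadix)).flatten.Perm
      ((List.range' 1 31).map ofMixedRadix) := by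
    rw [← List.map_flatten]
    exact (perm_of_mem_zeroSumPartitions L hL).map _
  obtain ⟨P, hdisj, hunion, hsum, hsize, hcount⟩ :=
    exists_zeroSum_partition (L.map (List.map ofMixedRadix))
      (hperm.nodup_iff.2 nodup_map_ofMixedRadix)
      (by
        simp only [List.mem_map, forall_exists_index, and_imp, forall_apply_eq_imp_iff₂, ne_eq,
          List.map_eq_nil_iff]
        rintro l hl rfl
        simpa using hlen [] hl)
      (by
        simp only [List.mem_map, forall_exists_index, and_imp, forall_apply_eq_imp_iff₂]
        exact sum_eq_zero_of_mem_zeroSumPartitions L hL)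
  have hfilter : ∀ k, (P.filter (fun s => s.card = k)).card =
      (L.filter (fun l => l.length = k)).length := fun k => by
    rw [hcount, List.filter_map, List.length_map]
    simp [Function.comp_def]
  refine ⟨P, hdisj, ?_, hsum, fun s hs => ?_, (hfilter 3).trans h3, (hfilter 4).trans h4,
    (hfilter 5).trans h5⟩
  · rw [hunion, List.toFinset_eq_of_perm _ _ hperm, toFinset_map_ofMixedRadix]
  · obtain ⟨m, hm, hs_card⟩ := hsize s hs
    obtain ⟨l, hl, rfl⟩ := List.mem_map.1 hm
    rw [hs_card, List.length_map]
    exact hlen l hl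
end
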